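/- arXiv:math/0508437 — 3 statements merged into one kernel-verified Lean document; each statement's English description precedes it below -/
import Mathlib

section
/- Assume the full-rank condition rank [Y;X] = R + C. Then a pair (β̂, Σ̂) with Σ̂ symmetric positive definite is a global maximizer of ℓ over ℝ^{C_R} × {symmetric positive definite R×R matrices} if and only if β̂ is a global minimizer of G over ℝ^{C_R} and Σ̂ = (1/N)·S(β̂). -/
open Matrix

/-- The coefficient matrix B(β) of the SUR model. -/
def surB {R C : ℕ} (CR : Set (Fin R × Fin C)) [DecidablePred (· ∈ CR)]
    (β : CR → ℝ) : Matrix (Fin R) (Fin C) ℝ :=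
  Matrix.of fun r c => if h : (r, c) ∈ CR then β ⟨(r, c), h⟩ else 0

/-- The residual sum-of-squares matrix S(β) = (Y − B(β)X)(Y − B(β)X)ᵀ. -/
def surS {R C N : ℕ} (Y : Matrix (Fin R) (Fin N) ℝ) (X : Matrix (Fin C) (Fin N) ℝ)
    (CR : Set (Fin R × Fin C)) [DecidablePred (· ∈ CR)]
    (β : CR → ℝ) : Matrix (Fin R) (Fin R) ℝ :=
  (Y - surB CR β * X) * (Y - surB CR β * X)ᵀ

/-- The Gaussian log-likelihood ℓ(β,Σ). -/
noncomputable def surLogLik {R C N : ℕ} (Y : Matrix (Fin R) (Fin N) ℝ)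
    (X : Matrix (Fin C) (Fin N) ℝ)
    (CR : Set (Fin R × Fin C)) [DecidablePred (· ∈ CR)]
    (β : CR → ℝ) (Sig : Matrix (Fin R) (Fin R) ℝ) : ℝ :=
  -(R * N / 2 : ℝ) * Real.log (2 * Real.pi) - (N / 2 : ℝ) * Real.log Sig.det
    - (1 / 2 : ℝ) * (Sig⁻¹ * surS Y X CR β).trace

/-- The polynomial objective G(β) = det S(β). -/
def surG {R C N : ℕ} (Y : Matrix (Fin R) (Fin N) ℝ) (X : Matrix (Fin C) (Fin N) ℝ)
    (CR : Set (Fin R × Fin C)) [DecidablePred (· ∈ CR)]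
    (β : CR → ℝ) : ℝ :=
  (surS Y X CR β).det

open scoped MatrixOrder Matrix.Norms.L2Operator in
/-- A positive definite matrix factors as `Aᴴ * A` with `A` invertible. -/
theorem Matrix.PosDef.exists_isUnit_conjTranspose_mul_self {n : Type*} [Fintype n] [DecidableEq n]
    {M : Matrix n n ℝ} (hM : M.PosDef) : ∃ A : Matrix n n ℝ, IsUnit A ∧ M = Aᴴ * A :=
  CStarAlgebra.isStrictlyPositive_iff_eq_star_mul_self.mp hM.isStrictlyPositive

/-- A Hermitian matrix all of whose eigenvalues are `1` is the identity. -/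
theorem Matrix.IsHermitian.eq_one_of_eigenvalues_eq_one {n : Type*} [Fintype n] [DecidableEq n]
    {M : Matrix n n ℝ} (hM : M.IsHermitian) (h : ∀ i, hM.eigenvalues i = 1) : M = 1 := by
  have hd : (RCLike.ofReal ∘ hM.eigenvalues : n → ℝ) = fun _ => 1 := by
    funext i
    simp [h i]
  rw [hM.spectral_theorem, hd, diagonal_one, map_one]

/-- The logarithm of the determinant is bounded by the trace minus the size. -/
theorem Matrix.PosDef.log_det_add_card_le_trace {n : Type*} [Fintype n] [DecidableEq n]
    {M : Matrix n n ℝ} (hM : M.PosDef) :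
    Real.log M.det + Fintype.card n ≤ M.trace ∧
      (M.trace ≤ Real.log M.det + Fintype.card n → M = 1) := by
  have hpos := hM.eigenvalues_pos
  have hlog : Real.log M.det = ∑ i, Real.log (hM.1.eigenvalues i) := by
    rw [hM.1.det_eq_prod_eigenvalues]
    exact Real.log_prod fun i _ => (hpos i).ne'
  have htr : M.trace = ∑ i, hM.1.eigenvalues i := hM.1.trace_eq_sum_eigenvalues
  have hle : ∀ i ∈ Finset.univ,
      Real.log (hM.1.eigenvalues i) + 1 ≤ hM.1.eigenvalues i := fun i _ => by
    linarith [Real.log_le_sub_one_of_pos (hpos i)]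
  have hsum : Real.log M.det + Fintype.card n =
      ∑ i, (Real.log (hM.1.eigenvalues i) + 1) := by
    rw [hlog, Finset.sum_add_distrib]
    simp
  rw [hsum, htr]
  have hle' := Finset.sum_le_sum hle
  refine ⟨hle', fun h => hM.1.eq_one_of_eigenvalues_eq_one fun i => ?_⟩
  by_contra hi
  have := (Finset.sum_eq_sum_iff_of_le hle).mp (hle'.antisymm h) i (Finset.mem_univ i)
  linarith [Real.log_lt_sub_one_of_pos (hpos i) hi]

/-- Gaussian relative entropy is nonnegative, and vanishes only at equal covariances. -/
theorem Matrix.PosDef.log_det_add_card_le_log_det_add_trace_inv_mul {n : Type*} [Fintype n]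
    [DecidableEq n] {S T : Matrix n n ℝ} (hS : S.PosDef) (hT : T.PosDef) :
    Real.log T.det + Fintype.card n ≤ Real.log S.det + (S⁻¹ * T).trace ∧
      (Real.log S.det + (S⁻¹ * T).trace ≤ Real.log T.det + Fintype.card n → S = T) := by
  obtain ⟨A, hA, hSA⟩ := hS.inv.exists_isUnit_conjTranspose_mul_self
  have hM : (A * T * Aᴴ).PosDef :=
    hT.mul_mul_conjTranspose_same (vecMul_injective_iff_isUnit.mpr hA)
  have htr : (A * T * Aᴴ).trace = (S⁻¹ * T).trace := by
    rw [hSA, Matrix.trace_mul_comm, Matrix.mul_assoc]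
  have hdet : (A * T * Aᴴ).det = S.det⁻¹ * T.det := by
    rw [← Ring.inverse_eq_inv', ← det_nonsing_inv, hSA]
    simp only [det_mul]
    ring
  have hlog : Real.log (A * T * Aᴴ).det = Real.log T.det - Real.log S.det := by
    rw [hdet, Real.log_mul (inv_ne_zero hS.det_pos.ne') hT.det_pos.ne', Real.log_inv]
    ring
  obtain ⟨h₁, h₂⟩ := hM.log_det_add_card_le_trace
  rw [hlog, htr] at h₁ h₂
  refine ⟨by linarith, fun h => ?_⟩
  have hone := h₂ (by linarith)
  have hinv : S⁻¹ * T = 1 := by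
    have : T * Aᴴ * A = 1 := mul_eq_one_comm.mp (by rw [← Matrix.mul_assoc, hone])
    rw [mul_eq_one_comm, hSA, ← Matrix.mul_assoc, this]
  have hSu : IsUnit S.det := hS.det_pos.ne'.isUnit
  rw [← Matrix.mul_one S, ← hinv, Matrix.mul_nonsing_inv_cancel_left _ _ hSu]

/-- A matrix whose rank equals its number of rows has injective left multiplication. -/
theorem Matrix.vecMul_injective_of_rank_eq_card {m n : Type*} [Fintype m] [Fintype n]
    {M : Matrix m n ℝ} (h : M.rank = Fintype.card m) : Function.Injective M.vecMul := by
  rw [Matrix.vecMul_injective_iff, linearIndependent_iff_card_eq_finrank_span, Set.finrank,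
    ← M.rank_eq_finrank_span_row, h]

/-- Under the full-rank condition every residual sum-of-squares matrix is positive definite. -/
theorem surS_posDef {R C N : ℕ} (Y : Matrix (Fin R) (Fin N) ℝ) (X : Matrix (Fin C) (Fin N) ℝ)
    (hrank : (Matrix.fromRows Y X).rank = R + C)
    (CR : Set (Fin R × Fin C)) [DecidablePred (· ∈ CR)] (β : CR → ℝ) :
    (surS Y X CR β).PosDef := by
  have hinj := Matrix.vecMul_injective_of_rank_eq_card
    (M := Matrix.fromRows Y X) (by simpa using hrank)
  have key : ∀ v : Fin R → ℝ, v ᵥ* (Y - surB CR β * X) =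
      Sum.elim v (-(v ᵥ* surB CR β)) ᵥ* Matrix.fromRows Y X := fun v => by
    rw [sumElim_vecMul_fromRows, vecMul_sub, neg_vecMul, vecMul_vecMul, sub_eq_add_neg]
  rw [surS, ← conjTranspose_eq_transpose_of_trivial]
  refine PosDef.mul_conjTranspose_self _ fun v w hvw => ?_
  have hvw' := hinj ((key v).symm.trans (hvw.trans (key w)))
  funext i
  exact congrFun hvw' (Sum.inl i)

/-- The log-likelihood in terms of the empirical covariance `(1/N) S(β)`. -/
theorem surLogLik_eq {R C N : ℕ} (hN : 0 < N) (Y : Matrix (Fin R) (Fin N) ℝ)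
    (X : Matrix (Fin C) (Fin N) ℝ) (CR : Set (Fin R × Fin C)) [DecidablePred (· ∈ CR)]
    (β : CR → ℝ) (Sig : Matrix (Fin R) (Fin R) ℝ) :
    surLogLik Y X CR β Sig = -(R * N / 2 : ℝ) * Real.log (2 * Real.pi) -
      (N / 2 : ℝ) * (Real.log Sig.det + (Sig⁻¹ * ((N : ℝ)⁻¹ • surS Y X CR β)).trace) := by
  have : (N : ℝ) ≠ 0 := by positivity
  rw [surLogLik, Matrix.mul_smul, Matrix.trace_smul, smul_eq_mul]
  field_simp
  ring

/-- Under the full-rank condition, (β̂,Σ̂) with Σ̂ positive definite is a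
global maximizer of ℓ iff β̂ is a global minimizer of G and Σ̂ = (1/N)·S(β̂). -/
theorem sur_global_max_iff
    {R C N : ℕ} (hR : 0 < R) (hC : 0 < C) (hN : 0 < N)
    (Y : Matrix (Fin R) (Fin N) ℝ) (X : Matrix (Fin C) (Fin N) ℝ)
    (hrank : (Matrix.fromRows Y X).rank = R + C)
    (CR : Set (Fin R × Fin C)) [DecidablePred (· ∈ CR)] :
    ∀ (βh : CR → ℝ) (Sigh : Matrix (Fin R) (Fin R) ℝ), Sigh.PosDef →
      ((∀ (β : CR → ℝ) (Sig : Matrix (Fin R) (Fin R) ℝ), Sig.PosDef →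
          surLogLik Y X CR β Sig ≤ surLogLik Y X CR βh Sigh)
        ↔ ((∀ β : CR → ℝ, surG Y X CR βh ≤ surG Y X CR β)
            ∧ Sigh = (N : ℝ)⁻¹ • surS Y X CR βh)) := by
  intro βh Sigh hSigh
  have hN' : (0 : ℝ) < N := by exact_mod_cast hN
  have hT : ∀ β : CR → ℝ, ((N : ℝ)⁻¹ • surS Y X CR β).PosDef := fun β =>
    (surS_posDef Y X hrank CR β).smul (inv_pos.mpr hN')
  have hlik : ∀ β β' Sig Sig', surLogLik Y X CR β Sig ≤ surLogLik Y X CR β' Sig' ↔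
      Real.log Sig'.det + (Sig'⁻¹ * ((N : ℝ)⁻¹ • surS Y X CR β')).trace ≤
        Real.log Sig.det + (Sig⁻¹ * ((N : ℝ)⁻¹ • surS Y X CR β)).trace := fun β β' Sig Sig' => by
    rw [surLogLik_eq hN, surLogLik_eq hN, sub_le_sub_iff_left, mul_le_mul_iff_right₀ (by positivity)]
  have hself : ∀ β, ((((N : ℝ)⁻¹ • surS Y X CR β)⁻¹ * ((N : ℝ)⁻¹ • surS Y X CR β)).trace : ℝ) =
      Fintype.card (Fin R) := fun β => by
    rw [Matrix.nonsing_inv_mul _ (hT β).det_pos.ne'.isUnit, Matrix.trace_one]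
  have hG : ∀ β β', surG Y X CR β ≤ surG Y X CR β' ↔
      Real.log ((N : ℝ)⁻¹ • surS Y X CR β).det ≤ Real.log ((N : ℝ)⁻¹ • surS Y X CR β').det :=
    fun β β' => by
      rw [Real.log_le_log_iff (hT β).det_pos (hT β').det_pos, det_smul, det_smul,
        mul_le_mul_iff_right₀ (by positivity), surG, surG]
  simp only [hlik, hG]
  constructor
  · intro h
    have heq : Sigh = (N : ℝ)⁻¹ • surS Y X CR βh :=
      (hSigh.log_det_add_card_le_log_det_add_trace_inv_mul (hT βh)).2
        ((h βh _ (hT βh)).trans_eq (by rw [hself]))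
    refine ⟨fun β => ?_, heq⟩
    have := h β _ (hT β)
    rw [heq, hself, hself] at this
    linarith
  · rintro ⟨hmin, rfl⟩ β Sig hSig
    rw [hself]
    linarith [hmin β, (hSig.log_det_add_card_le_log_det_add_trace_inv_mul (hT β)).1]
end

section
/- Assume the full-rank condition rank [Y;X] = R + C. Then G attains its minimum over ℝ^{C_R}: there exists β̂ ∈ ℝ^{C_R} with G(β̂) ≤ G(β) for all β ∈ ℝ^{C_R}. Consequently the likelihood function ℓ attains its maximum over ℝ^{C_R} × {symmetric positive definite R×R matrices}. -/
open Matrix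

lemma one_add_sum_le_prod_one_add_of_nonneg {ι : Type*} (s : Finset ι) (t : ι → ℝ)
    (ht : ∀ i, 0 ≤ t i) : 1 + ∑ i ∈ s, t i ≤ ∏ i ∈ s, (1 + t i) := by
  classical
  induction s using Finset.induction_on with
  | empty => simp
  | insert a s ha ih =>
    rw [Finset.sum_insert ha, Finset.prod_insert ha]
    nlinarith [ht a, mul_nonneg (ht a) (Finset.sum_nonneg fun i (_ : i ∈ s) => ht i)]

section

variable {n : Type*} [Fintype n] [DecidableEq n]

lemma Matrix.IsHermitian.posSemidef_sub_smul_one_iff {A : Matrix n n ℝ} (hA : A.IsHermitian)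
    (m : ℝ) : (A - m • (1 : Matrix n n ℝ)).PosSemidef ↔ ∀ i, m ≤ hA.eigenvalues i := by
  have h : A - m • (1 : Matrix n n ℝ) = Unitary.conjStarAlgAut ℝ _ hA.eigenvectorUnitary
      (diagonal (fun i => hA.eigenvalues i - m)) := by
    have hd : diagonal (fun i => hA.eigenvalues i - m)
        = diagonal (RCLike.ofReal ∘ hA.eigenvalues) - m • (1 : Matrix n n ℝ) := by
      ext i j
      by_cases hij : i = j <;> simp [hij]
    rw [hd, map_sub, map_smul, map_one]
    congr 1
    exact hA.spectral_theorem
  rw [h, Unitary.conjStarAlgAut_apply,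
    Matrix.IsUnit.posSemidef_star_right_conjugate_iff Unitary.isUnit_coe, posSemidef_diagonal_iff]
  simp

lemma Matrix.PosDef.exists_pos_posSemidef_sub_smul_one {A : Matrix n n ℝ} (hA : A.PosDef) :
    ∃ m : ℝ, 0 < m ∧ (A - m • (1 : Matrix n n ℝ)).PosSemidef := by
  obtain ⟨m, hm, h⟩ : ∃ m : ℝ, 0 < m ∧ ∀ i, m ≤ hA.1.eigenvalues i := by
    cases isEmpty_or_nonempty n
    · exact ⟨1, one_pos, fun i => isEmptyElim i⟩
    · obtain ⟨i, hi⟩ := Finite.exists_min hA.1.eigenvalues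
      exact ⟨_, hA.eigenvalues_pos i, hi⟩
  exact ⟨m, hm, (hA.1.posSemidef_sub_smul_one_iff m).2 h⟩

lemma Matrix.IsHermitian.le_det_of_posSemidef_sub_smul_one {A : Matrix n n ℝ}
    (hA : A.IsHermitian) {m : ℝ} (hm : 0 < m)
    (h : (A - m • (1 : Matrix n n ℝ)).PosSemidef) :
    m ^ Fintype.card n * (1 + (A.trace / m - Fintype.card n)) ≤ A.det := by
  have hle := (hA.posSemidef_sub_smul_one_iff m).1 h
  have hprod := one_add_sum_le_prod_one_add_of_nonneg Finset.univ
    (fun i => hA.eigenvalues i / m - 1)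
    (fun i => sub_nonneg.2 ((one_le_div hm).2 (hle i)))
  have htr : A.trace = ∑ i, hA.eigenvalues i := by simpa using hA.trace_eq_sum_eigenvalues
  have hdet : A.det = m ^ Fintype.card n * ∏ i, (1 + (hA.eigenvalues i / m - 1)) := by
    rw [hA.det_eq_prod_eigenvalues, ← Finset.card_univ, ← Finset.prod_const,
      ← Finset.prod_mul_distrib]
    refine Finset.prod_congr rfl fun i _ => ?_
    simp only [RCLike.ofReal_real_eq_id, id_eq]
    field_simp
    ring
  rw [hdet, htr]
  refine mul_le_mul_of_nonneg_left ?_ (by positivity)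
  simpa [Finset.sum_sub_distrib, Finset.sum_div] using hprod

lemma Matrix.PosDef.log_det_le_trace_sub_card {A : Matrix n n ℝ} (hA : A.PosDef) :
    Real.log A.det ≤ A.trace - Fintype.card n := by
  have htr : A.trace = ∑ i, hA.1.eigenvalues i := by simpa using hA.1.trace_eq_sum_eigenvalues
  have hdet : A.det = ∏ i, hA.1.eigenvalues i := by simpa using hA.1.det_eq_prod_eigenvalues
  rw [hdet, htr, Real.log_prod fun i _ => (hA.eigenvalues_pos i).ne']
  calc ∑ i, Real.log (hA.1.eigenvalues i) ≤ ∑ i, (hA.1.eigenvalues i - 1) :=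
        Finset.sum_le_sum fun i _ => Real.log_le_sub_one_of_pos (hA.eigenvalues_pos i)
    _ = _ := by simp [Finset.sum_sub_distrib]

open scoped MatrixOrder Matrix.Norms.L2Operator in
lemma Matrix.PosDef.log_det_add_card_le {S T : Matrix n n ℝ} (hS : S.PosDef) (hT : T.PosDef) :
    Real.log S.det + Fintype.card n ≤ Real.log T.det + (T⁻¹ * S).trace := by
  obtain ⟨B, hB⟩ := CStarAlgebra.nonneg_iff_eq_star_mul_self.mp hT.inv.posSemidef.nonneg
  rw [star_eq_conjTranspose] at hB
  have hdet : (B * S * Bᴴ).det = T.det⁻¹ * S.det := by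
    rw [mul_assoc, det_mul_comm, mul_assoc, ← hB, det_mul, det_nonsing_inv,
      Ring.inverse_eq_inv', mul_comm]
  have htr : (B * S * Bᴴ).trace = (T⁻¹ * S).trace := by
    rw [trace_mul_comm, ← mul_assoc, ← hB]
  have hA : (B * S * Bᴴ).PosDef := by
    rw [(hS.posSemidef.mul_mul_conjTranspose_same B).posDef_iff_det_ne_zero, hdet]
    exact mul_ne_zero (inv_ne_zero hT.det_pos.ne') hS.det_pos.ne'
  have h := hA.log_det_le_trace_sub_card
  rw [hdet, htr, Real.log_mul (inv_ne_zero hT.det_pos.ne') hS.det_pos.ne', Real.log_inv] at h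
  linarith

end

lemma Matrix.posDef_mul_conjTranspose_of_rank_eq_card {n k : Type*} [Fintype n] [Fintype k]
    {M : Matrix n k ℝ} (h : M.rank = Fintype.card n) : (M * Mᴴ).PosDef := by
  refine PosDef.mul_conjTranspose_self M ?_
  rw [vecMul_injective_iff, linearIndependent_iff_card_eq_finrank_span, ← h]
  exact rank_eq_finrank_span_row M

section

variable {R C N : ℕ} (Y : Matrix (Fin R) (Fin N) ℝ) (X : Matrix (Fin C) (Fin N) ℝ)
  (CR : Set (Fin R × Fin C)) [DecidablePred (· ∈ CR)]

lemma surS_isHermitian (β : CR → ℝ) : (surS Y X CR β).IsHermitian := by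
  unfold surS
  simpa using isHermitian_mul_conjTranspose_self (Y - surB CR β * X)

lemma continuous_surG : Continuous (surG Y X CR) := by
  have hB : Continuous fun β : CR → ℝ => surB CR β := by
    refine continuous_matrix fun r c => ?_
    by_cases h : (r, c) ∈ CR
    · simpa [surB, h] using continuous_apply (⟨(r, c), h⟩ : CR)
    · simpa [surB, h] using continuous_const
  unfold surG surS
  fun_prop

lemma norm_le_one_add_trace_surB_mul_transpose (β : CR → ℝ) :
    ‖β‖ ≤ 1 + (surB CR β * (surB CR β)ᵀ).trace := by
  have htr : (surB CR β * (surB CR β)ᵀ).trace = ∑ r, ∑ c, surB CR β r c ^ 2 := by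
    simp [trace, mul_apply, sq]
  have hnn : 0 ≤ ∑ r, ∑ c, surB CR β r c ^ 2 := by positivity
  rw [htr, pi_norm_le_iff_of_nonneg (by positivity)]
  rintro ⟨⟨r, c⟩, h⟩
  have hle : surB CR β r c ^ 2 ≤ ∑ r, ∑ c, surB CR β r c ^ 2 :=
    (Finset.single_le_sum (f := fun c => surB CR β r c ^ 2) (fun _ _ => sq_nonneg _)
      (Finset.mem_univ c)).trans
      (Finset.single_le_sum (f := fun r => ∑ c, surB CR β r c ^ 2)
        (fun _ _ => Finset.sum_nonneg fun _ _ => sq_nonneg _) (Finset.mem_univ r))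
  have hval : surB CR β r c = β ⟨(r, c), h⟩ := by simp [surB, h]
  rw [hval] at hle
  rw [Real.norm_eq_abs]
  nlinarith [sq_abs (β ⟨(r, c), h⟩), sq_nonneg (|β ⟨(r, c), h⟩| - 1)]

lemma exists_posSemidef_surS_sub (hrank : (Matrix.fromRows Y X).rank = R + C) :
    ∃ m : ℝ, 0 < m ∧ ∀ β : CR → ℝ,
      (surS Y X CR β - m • (1 + surB CR β * (surB CR β)ᵀ)).PosSemidef := by
  obtain ⟨m, hm, h⟩ := (posDef_mul_conjTranspose_of_rank_eq_card
    (M := fromRows Y X) (by simpa using hrank)).exists_pos_posSemidef_sub_smul_one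
  refine ⟨m, hm, fun β => ?_⟩
  set K : Matrix (Fin R) (Fin R ⊕ Fin C) ℝ := fromCols 1 (-surB CR β) with hKdef
  have hK := h.mul_mul_conjTranspose_same K
  have h1 : K * fromRows Y X = Y - surB CR β * X := by
    rw [hKdef, fromCols_mul_fromRows]
    simp [sub_eq_add_neg]
  have h2 : K * Kᵀ = 1 + surB CR β * (surB CR β)ᵀ := by
    rw [hKdef, transpose_fromCols, fromCols_mul_fromRows]
    simp
  convert hK using 1
  simp only [conjTranspose_eq_transpose_of_trivial] at *
  rw [← h2, surS, ← h1, transpose_mul, Matrix.mul_sub, Matrix.sub_mul]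
  simp [Matrix.mul_assoc]

end

/-- Under the full-rank condition, G attains its minimum over ℝ^{C_R};
consequently the likelihood attains its maximum over ℝ^{C_R} × {positive definite Σ}. -/
theorem sur_min_exists
    {R C N : ℕ} (hR : 0 < R) (hC : 0 < C) (hN : 0 < N)
    (Y : Matrix (Fin R) (Fin N) ℝ) (X : Matrix (Fin C) (Fin N) ℝ)
    (hrank : (Matrix.fromRows Y X).rank = R + C)
    (CR : Set (Fin R × Fin C)) [DecidablePred (· ∈ CR)] :
    (∃ βh : CR → ℝ, ∀ β : CR → ℝ, surG Y X CR βh ≤ surG Y X CR β)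
    ∧ (∃ (βh : CR → ℝ) (Sigh : Matrix (Fin R) (Fin R) ℝ), Sigh.PosDef ∧
        ∀ (β : CR → ℝ) (Sig : Matrix (Fin R) (Fin R) ℝ), Sig.PosDef →
          surLogLik Y X CR β Sig ≤ surLogLik Y X CR βh Sigh) := by
  obtain ⟨m, hm, hS⟩ := exists_posSemidef_surS_sub Y X CR hrank
  have hS1 : ∀ β, (surS Y X CR β - m • (1 : Matrix (Fin R) (Fin R) ℝ)).PosSemidef := fun β => by
    have h := (hS β).add
      ((posSemidef_self_mul_conjTranspose (surB CR β)).smul hm.le)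
    convert h using 1
    simp [smul_add, sub_add_eq_sub_sub]
  have hpd : ∀ β, (surS Y X CR β).PosDef := fun β => by
    simpa using PosDef.posSemidef_add (hS1 β) (PosDef.one.smul hm)
  have hlow : ∀ β, m ^ R * ‖β‖ ≤ surG Y X CR β := fun β => by
    refine le_trans ?_ (by simpa [surG] using
      (surS_isHermitian Y X CR β).le_det_of_posSemidef_sub_smul_one hm (hS1 β))
    refine mul_le_mul_of_nonneg_left ?_ (by positivity)
    refine (norm_le_one_add_trace_surB_mul_transpose CR β).trans ?_
    have h := (hS β).trace_nonneg
    rw [trace_sub, trace_smul, trace_add, trace_one, Fintype.card_fin, smul_eq_mul] at h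
    rw [add_le_add_iff_left, le_sub_iff_add_le, le_div_iff₀ hm]
    linarith
  obtain ⟨βh, hmin⟩ : ∃ βh : CR → ℝ, ∀ β : CR → ℝ, surG Y X CR βh ≤ surG Y X CR β :=
    (continuous_surG Y X CR).exists_forall_le <| Filter.tendsto_atTop_mono hlow <|
      (tendsto_norm_cocompact_atTop (E := CR → ℝ)).const_mul_atTop (by positivity)
  refine ⟨⟨βh, hmin⟩, βh, (N : ℝ)⁻¹ • surS Y X CR βh, ?_, fun β Sig hSig => ?_⟩
  · exact (hpd βh).smul (by positivity)
  have hNpos : (0 : ℝ) < N := by exact_mod_cast hN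
  have hkey := ((hpd β).smul (inv_pos.2 hNpos)).log_det_add_card_le hSig
  have hmono : Real.log ((N : ℝ)⁻¹ • surS Y X CR βh).det
      ≤ Real.log ((N : ℝ)⁻¹ • surS Y X CR β).det := by
    refine Real.log_le_log ((hpd βh).smul (inv_pos.2 hNpos)).det_pos ?_
    rw [det_smul, det_smul]
    exact mul_le_mul_of_nonneg_left (hmin β) (by positivity)
  have htr : (((N : ℝ)⁻¹ • surS Y X CR βh)⁻¹ * surS Y X CR βh).trace = N * R := by
    have hu := (hpd βh).isUnit
    rw [isUnit_iff_isUnit_det] at hu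
    have hinv : ((N : ℝ)⁻¹ • surS Y X CR βh)⁻¹ = (N : ℝ) • (surS Y X CR βh)⁻¹ := by
      refine inv_eq_right_inv ?_
      rw [smul_mul_smul_comm, inv_mul_cancel₀ hNpos.ne', one_smul, mul_nonsing_inv _ hu]
    rw [hinv, smul_mul_assoc, nonsing_inv_mul _ hu]
    simp
  rw [Matrix.mul_smul, trace_smul, smul_eq_mul, Fintype.card_fin] at hkey
  unfold surLogLik
  rw [htr]
  have h := mul_le_mul_of_nonneg_left (add_le_add_left hmono R |>.trans hkey) hNpos.le
  rw [mul_add, mul_add, mul_inv_cancel_left₀ hNpos.ne'] at h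
  linarith
end

section
/- Let Σ be a symmetric positive definite real R×R matrix and suppose X ∈ ℝ^{C×N} has rank C. Let A be the (C×R)-by-C_R real matrix whose column indexed by (r,c) ∈ C_R is the standard basis vector of ℝ^{C×R} with a 1 in position (c,r), so that vec(B(β)) = Aβ for all β, where vec stacks a matrix into a vector indexed by (column, row) pairs. Then: (i) the C_R × C_R matrix M = Aᵀ((XXᵀ) ⊗ Σ⁻¹)A is symmetric positive definite (in particular invertible), where ⊗ is the Kronecker product; and (ii) for each β ∈ ℝ^{C_R}, the gradient with respect to β of β ↦ ℓ(β,Σ) vanishes at β if and only if Mβ = Aᵀ vec(Σ⁻¹ Y Xᵀ), equivalently β = M⁻¹ Aᵀ vec(Σ⁻¹ Y Xᵀ); so this stationary point in β is unique. -/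
open Matrix Kronecker

/-- vec stacks a matrix into a vector indexed by (column, row) pairs. -/
def vecM {R C : ℕ} (M : Matrix (Fin R) (Fin C) ℝ) : Fin C × Fin R → ℝ :=
  fun p => M p.2 p.1

/-- The zero-one matrix A whose column indexed by (r,c) ∈ C_R is the standard basis
vector of ℝ^{C×R} with a 1 in position (c,r). -/
def surA {R C : ℕ} (CR : Set (Fin R × Fin C)) [DecidablePred (· ∈ CR)] :
    Matrix (Fin C × Fin R) CR ℝ :=
  Matrix.of fun p q => if p.1 = q.1.2 ∧ p.2 = q.1.1 then 1 else 0

/-- The gradient of the quadratic function `b ↦ c + b ⬝ᵥ g - (b ⬝ᵥ M *ᵥ b) / 2` with symmetric `M`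
is `g - M *ᵥ b`. -/
theorem fderiv_quadratic_apply {ι : Type*} [Fintype ι] (c : ℝ) (g : ι → ℝ) {M : Matrix ι ι ℝ}
    (hM : M.IsSymm) (b v : ι → ℝ) :
    fderiv ℝ (fun x : ι → ℝ => c + x ⬝ᵥ g - (1 / 2 : ℝ) * (x ⬝ᵥ M *ᵥ x)) b v
      = v ⬝ᵥ (g - M *ᵥ b) := by
  have hdiff : DifferentiableAt ℝ
      (fun x : ι → ℝ => c + x ⬝ᵥ g - (1 / 2 : ℝ) * (x ⬝ᵥ M *ᵥ x)) b := by
    simp only [dotProduct, mulVec]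
    fun_prop
  have hsymm : b ⬝ᵥ M *ᵥ v = v ⬝ᵥ M *ᵥ b := by
    rw [dotProduct_mulVec, ← mulVec_transpose, hM.eq, dotProduct_comm]
  have hline : (fun t : ℝ =>
        c + (b + t • v) ⬝ᵥ g - (1 / 2 : ℝ) * ((b + t • v) ⬝ᵥ M *ᵥ (b + t • v)))
      = fun t : ℝ => (c + b ⬝ᵥ g - (1 / 2 : ℝ) * (b ⬝ᵥ M *ᵥ b)) + t * (v ⬝ᵥ (g - M *ᵥ b))
        - t ^ 2 * ((1 / 2 : ℝ) * (v ⬝ᵥ M *ᵥ v)) := by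
    funext t
    simp only [mulVec_add, mulVec_smul, add_dotProduct, dotProduct_add, smul_dotProduct,
      dotProduct_smul, dotProduct_sub, smul_eq_mul, hsymm]
    ring
  rw [← hdiff.lineDeriv_eq_fderiv, lineDeriv, hline]
  have hderiv := (((hasDerivAt_id (0 : ℝ)).mul_const (v ⬝ᵥ (g - M *ᵥ b))).const_add
    (c + b ⬝ᵥ g - (1 / 2 : ℝ) * (b ⬝ᵥ M *ᵥ b))).sub
    (((hasDerivAt_id (0 : ℝ)).pow 2).mul_const ((1 / 2 : ℝ) * (v ⬝ᵥ M *ᵥ v)))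
  exact hderiv.deriv.trans (by simp)

/-- A symmetric quadratic function is stationary exactly at the solutions of its normal
equations. -/
theorem fderiv_quadratic_eq_zero_iff {ι : Type*} [Fintype ι] (c : ℝ) (g : ι → ℝ)
    {M : Matrix ι ι ℝ} (hM : M.IsSymm) (b : ι → ℝ) :
    fderiv ℝ (fun x : ι → ℝ => c + x ⬝ᵥ g - (1 / 2 : ℝ) * (x ⬝ᵥ M *ᵥ x)) b = 0
      ↔ M *ᵥ b = g := by
  rw [ContinuousLinearMap.ext_iff]
  simp only [fderiv_quadratic_apply c g hM, _root_.zero_apply]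
  refine ⟨fun h => ?_, fun h v => by simp [h]⟩
  exact (sub_eq_zero.mp (dotProduct_self_eq_zero.mp (h (g - M *ᵥ b)))).symm

/-- A real matrix of full row rank has a positive definite Gram matrix of rows. -/
theorem posDef_self_mul_transpose_of_rank_eq {m n : Type*} [Fintype m] [Fintype n]
    {X : Matrix m n ℝ} (hX : X.rank = Fintype.card m) : (X * Xᵀ).PosDef := by
  rw [← conjTranspose_eq_transpose_of_trivial]
  refine PosDef.mul_conjTranspose_self X ?_
  rw [vecMul_injective_iff, linearIndependent_iff_card_eq_finrank_span, Set.finrank,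
    ← rank_eq_finrank_span_row, hX]

theorem vec_surB {R C : ℕ} (CR : Set (Fin R × Fin C)) [DecidablePred (· ∈ CR)] (β : CR → ℝ) :
    (surB CR β).vec = surA CR *ᵥ β := by
  ext ⟨c, r⟩
  simp only [vec, surB, of_apply, mulVec, dotProduct, surA, ite_mul, one_mul, zero_mul]
  split_ifs with h
  · rw [Finset.sum_eq_single ⟨(r, c), h⟩]
    · simp
    · rintro ⟨⟨r', c'⟩, h'⟩ - hne
      refine if_neg fun ⟨hc, hr⟩ => hne ?_
      simp_all
    · simp
  · refine (Finset.sum_eq_zero ?_).symm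
    rintro ⟨⟨r', c'⟩, h'⟩ -
    refine if_neg fun ⟨hc, hr⟩ => h ?_
    simp_all

theorem surA_mulVec_injective {R C : ℕ} (CR : Set (Fin R × Fin C)) [DecidablePred (· ∈ CR)] :
    Function.Injective (surA CR).mulVec := by
  intro β γ h
  simp only [← vec_surB, vec_inj] at h
  ext ⟨⟨r, c⟩, hrc⟩
  simpa [surB, hrc] using congrFun (congrFun h r) c

theorem posDef_surA_gram {R C N : ℕ} {X : Matrix (Fin C) (Fin N) ℝ} (hX : X.rank = C)
    (CR : Set (Fin R × Fin C)) [DecidablePred (· ∈ CR)]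
    {Sig : Matrix (Fin R) (Fin R) ℝ} (hSig : Sig.PosDef) :
    ((surA CR)ᵀ * ((X * Xᵀ) ⊗ₖ Sig⁻¹) * surA CR).PosDef := by
  rw [← conjTranspose_eq_transpose_of_trivial (surA CR)]
  exact ((posDef_self_mul_transpose_of_rank_eq (by simpa using hX)).kronecker
    hSig.inv).conjTranspose_mul_mul_same (surA_mulVec_injective CR)

/-- The generalized residual sum of squares, expanded in the coefficient matrix. -/
theorem trace_mul_residual {m n k : Type*} [Fintype m] [Fintype n] [Fintype k]
    {P : Matrix m m ℝ} (hP : P.IsSymm) (Y : Matrix m n ℝ) (B : Matrix m k ℝ) (X : Matrix k n ℝ) :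
    (P * ((Y - B * X) * (Y - B * X)ᵀ)).trace
      = (P * (Y * Yᵀ)).trace - 2 * (B.vec ⬝ᵥ (P * Y * Xᵀ).vec)
        + B.vec ⬝ᵥ ((X * Xᵀ) ⊗ₖ P) *ᵥ B.vec := by
  have hcross : (P * (Y * (B * X)ᵀ)).trace = (Bᵀ * (P * Y * Xᵀ)).trace := by
    rw [trace_mul_comm Bᵀ, transpose_mul]
    simp only [Matrix.mul_assoc]
  have hcross' : (P * (B * X * Yᵀ)).trace = (Bᵀ * (P * Y * Xᵀ)).trace := by
    rw [← hcross, ← trace_transpose, transpose_mul, hP.eq, trace_mul_comm, transpose_mul,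
      transpose_transpose]
  have hquad : (P * (B * X * (B * X)ᵀ)).trace = (Bᵀ * (P * B * (X * Xᵀ))).trace := by
    rw [trace_mul_comm Bᵀ, transpose_mul]
    simp only [Matrix.mul_assoc]
  rw [kronecker_mulVec_vec, vec_dotProduct_vec, vec_dotProduct_vec, transpose_mul,
    transpose_transpose, transpose_sub]
  simp only [Matrix.sub_mul, Matrix.mul_sub, trace_sub, hcross, hcross', hquad]
  ring

theorem surLogLik_eq_quadratic {R C N : ℕ} (Y : Matrix (Fin R) (Fin N) ℝ)
    (X : Matrix (Fin C) (Fin N) ℝ) (CR : Set (Fin R × Fin C)) [DecidablePred (· ∈ CR)]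
    {Sig : Matrix (Fin R) (Fin R) ℝ} (hSig : Sig.IsSymm) (β : CR → ℝ) :
    surLogLik Y X CR β Sig
      = -(R * N / 2 : ℝ) * Real.log (2 * Real.pi) - (N / 2 : ℝ) * Real.log Sig.det
          - (1 / 2 : ℝ) * (Sig⁻¹ * (Y * Yᵀ)).trace
        + β ⬝ᵥ (surA CR)ᵀ *ᵥ (Sig⁻¹ * Y * Xᵀ).vec
        - (1 / 2 : ℝ) * (β ⬝ᵥ ((surA CR)ᵀ * ((X * Xᵀ) ⊗ₖ Sig⁻¹) * surA CR) *ᵥ β) := by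
  have hA : ∀ w, β ⬝ᵥ (surA CR)ᵀ *ᵥ w = surA CR *ᵥ β ⬝ᵥ w := fun w => by
    rw [dotProduct_mulVec, vecMul_transpose]
  have hP : Sig⁻¹.IsSymm := by rw [IsSymm, transpose_nonsing_inv, hSig.eq]
  rw [surLogLik, surS, trace_mul_residual hP, ← mulVec_mulVec, ← mulVec_mulVec, hA, hA, vec_surB]
  ring

/-- With Σ positive definite and X of full rank C, the matrix
M = Aᵀ((XXᵀ) ⊗ Σ⁻¹)A is symmetric positive definite, vec(B(β)) = Aβ, and the
gradient of β ↦ ℓ(β,Σ) vanishes at β iff Mβ = Aᵀ vec(Σ⁻¹YXᵀ), equivalently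
β = M⁻¹Aᵀ vec(Σ⁻¹YXᵀ); hence the stationary point in β is unique. -/
theorem sur_beta_stationary
    {R C N : ℕ} (hR : 0 < R) (hC : 0 < C) (hN : 0 < N)
    (Y : Matrix (Fin R) (Fin N) ℝ) (X : Matrix (Fin C) (Fin N) ℝ)
    (hX : X.rank = C)
    (CR : Set (Fin R × Fin C)) [DecidablePred (· ∈ CR)]
    (Sig : Matrix (Fin R) (Fin R) ℝ) (hSig : Sig.PosDef) :
    (∀ β : CR → ℝ, vecM (surB CR β) = (surA CR).mulVec β)
    ∧ ((surA CR)ᵀ * ((X * Xᵀ) ⊗ₖ Sig⁻¹) * surA CR).PosDef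
    ∧ ∀ β : CR → ℝ,
        (fderiv ℝ (fun b => surLogLik Y X CR b Sig) β = 0
          ↔ ((surA CR)ᵀ * ((X * Xᵀ) ⊗ₖ Sig⁻¹) * surA CR).mulVec β
              = (surA CR)ᵀ.mulVec (vecM (Sig⁻¹ * Y * Xᵀ)))
        ∧ (((surA CR)ᵀ * ((X * Xᵀ) ⊗ₖ Sig⁻¹) * surA CR).mulVec β
              = (surA CR)ᵀ.mulVec (vecM (Sig⁻¹ * Y * Xᵀ))
          ↔ β = ((surA CR)ᵀ * ((X * Xᵀ) ⊗ₖ Sig⁻¹) * surA CR)⁻¹.mulVec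
              ((surA CR)ᵀ.mulVec (vecM (Sig⁻¹ * Y * Xᵀ)))) := by
  have hM := posDef_surA_gram hX CR hSig
  refine ⟨vec_surB CR, hM, fun β => ⟨?_, ?_⟩⟩
  · have hSymm : Sig.IsSymm := by simpa [IsHermitian, IsSymm] using hSig.isHermitian
    simp only [surLogLik_eq_quadratic Y X CR hSymm]
    exact fderiv_quadratic_eq_zero_iff _ _ (by simpa [IsHermitian, IsSymm] using hM.isHermitian) β
  · have hdet := (isUnit_iff_isUnit_det _).mp hM.isUnit
    constructor
    · intro h
      rw [← h, mulVec_mulVec, nonsing_inv_mul _ hdet, one_mulVec]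
    · intro h
      rw [h, mulVec_mulVec, mul_nonsing_inv _ hdet, one_mulVec]
end
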